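/- arXiv:2604.07515 — 4 statements merged into one kernel-verified Lean document; each statement's English description precedes it below -/
import Mathlib

section
/- Let G=(V,E) be a finite simple graph, V^? ⊆ V, E^? ⊆ E, and π a permutation of V. For every X ⊆ V^? and every F ⊆ E^?, letting G' be the graph obtained from G by deleting the vertices in X (together with their incident edges) and the edges in F, we have LFMIS(G',π) △ LFMIS(G,π) ⊆ InfluenceMIS(G, V^?, E^?, 1), where △ denotes symmetric difference of vertex sets. (That is, InfluenceMIS conservatively solves the influence analysis problem for LFMIS.) -/
open Finset

/-- `lfmisAux W E π i` : the vertex at π-position `i` is in the greedy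
lexicographically-first MIS of the graph with vertex set `W` and edge set `E`. -/
def lfmisAux {n : ℕ} (W : Set (Fin n)) (E : Set (Sym2 (Fin n))) (π : Equiv.Perm (Fin n))
    (i : ℕ) : Prop :=
  (∃ h : i < n, π ⟨i, h⟩ ∈ W) ∧
    ∀ j, j < i →
      (∃ (h1 : j < n) (h2 : i < n), π ⟨j, h1⟩ ∈ W ∧ π ⟨i, h2⟩ ∈ W ∧
        s(π ⟨j, h1⟩, π ⟨i, h2⟩) ∈ E) → ¬ lfmisAux W E π j
termination_by i

/-- The lexicographically-first MIS of the graph with vertex set `W ⊆ Fin n`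
and edge set `E`, under the permutation `π` (position `i` holds vertex `π i`). -/
def LFMISOn {n : ℕ} (W : Set (Fin n)) (E : Set (Sym2 (Fin n)))
    (π : Equiv.Perm (Fin n)) : Set (Fin n) :=
  {v | v ∈ W ∧ lfmisAux W E π (π.symm v : ℕ)}

/-- State of the `InfluenceMIS` procedure: alive vertices, surviving edges,
undecided vertices, undecided edges. -/
structure MISState (n : ℕ) where
  verts : Finset (Fin n)
  edges : Finset (Sym2 (Fin n))
  uV : Finset (Fin n)
  uE : Finset (Sym2 (Fin n))

/-- Current neighbors of `u`. -/
def MISState.nbrs {n : ℕ} (st : MISState n) (u : Fin n) : Finset (Fin n) :=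
  st.verts.filter fun v => v ≠ u ∧ s(u, v) ∈ st.edges

/-- One iteration of `InfluenceMIS`, processing vertex `u`.  If `u` is not alive,
nothing happens.  If `u` is undecided, all of its neighbors become undecided and
`u` is deleted (it joins the influence set).  Otherwise `u` is (implicitly) added
to the MIS: its neighbors along undecided edges become undecided, its neighbors
along decided edges are deleted, and `u` is deleted. -/
def stepInf {n : ℕ} (st : MISState n) (u : Fin n) : MISState n :=
  if u ∉ st.verts then st
  else if u ∈ st.uV then
    { verts := st.verts.erase u
      edges := st.edges.filter fun e => u ∉ e
      uV := (st.uV ∪ st.nbrs u).erase u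
      uE := st.uE.filter fun e => u ∉ e }
  else
    let D := (st.nbrs u).filter fun v => s(u, v) ∉ st.uE
    let U := (st.nbrs u).filter fun v => s(u, v) ∈ st.uE
    { verts := (st.verts.erase u) \ D
      edges := st.edges.filter fun e => u ∉ e ∧ ∀ v ∈ D, v ∉ e
      uV := ((st.uV ∪ U) \ D).erase u
      uE := st.uE.filter fun e => u ∉ e ∧ ∀ v ∈ D, v ∉ e }

/-- `stateAt π st0 i` : the state at the beginning of (0-based) iteration `i`
of `InfluenceMIS` started from `st0`, where position `i` holds vertex `π i`
(so 1-based iteration `i` of the paper corresponds to `stateAt π st0 (i-1)`). -/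
def stateAt {n : ℕ} (π : Equiv.Perm (Fin n)) (st0 : MISState n) : ℕ → MISState n
  | 0 => st0
  | i + 1 => if h : i < n then stepInf (stateAt π st0 i) (π ⟨i, h⟩) else stateAt π st0 i

/-- The influence set returned by `InfluenceMIS`: vertices that are alive and
undecided at the beginning of their own iteration. -/
def influenceMIS {n : ℕ} (π : Equiv.Perm (Fin n)) (st0 : MISState n) : Finset (Fin n) :=
  Finset.univ.filter fun v =>
    v ∈ (stateAt π st0 (π.symm v : ℕ)).verts ∧ v ∈ (stateAt π st0 (π.symm v : ℕ)).uV

/-- Initial state of `InfluenceMIS` on a graph `G` with undecided vertices `uV`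
and undecided edges `uE`. -/
def initState {n : ℕ} (G : SimpleGraph (Fin n)) [DecidableRel G.Adj]
    (uV : Finset (Fin n)) (uE : Finset (Sym2 (Fin n))) : MISState n :=
  ⟨Finset.univ, G.edgeFinset, uV, uE⟩

theorem mem_LFMISOn_iff {n : ℕ} (W : Set (Fin n)) (E : Set (Sym2 (Fin n)))
    (π : Equiv.Perm (Fin n)) (v : Fin n) :
    v ∈ LFMISOn W E π ↔
      v ∈ W ∧ ∀ u, π.symm u < π.symm v → s(u, v) ∈ E → u ∉ LFMISOn W E π := by
  simp only [LFMISOn, Set.mem_ofPred_eq]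
  refine and_congr_right fun hv => ?_
  rw [lfmisAux]
  constructor
  · rintro ⟨-, h⟩ u hu he ⟨huW, hu'⟩
    exact h _ hu ⟨(π.symm u).2, (π.symm v).2, by simpa using ⟨huW, hv, he⟩⟩ hu'
  · refine fun h => ⟨⟨(π.symm v).2, by simpa using hv⟩, ?_⟩
    rintro j hj ⟨h1, h2, hW, -, he⟩ hj'
    refine h (π ⟨j, h1⟩) (by simpa [Fin.lt_def] using hj) (by simpa using he) ⟨hW, ?_⟩
    simpa using hj'

/-- The invariant maintained by `InfluenceMIS` before iteration `i`, relative to two vertex sets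
`M` and `M'`: dead unprocessed vertices lie in neither set, decided unprocessed vertices have no
processed neighbor in either set, and surviving edges are those of the input between alive
vertices. -/
structure InfluenceInvariant {n : ℕ} (E uE : Set (Sym2 (Fin n))) (X : Set (Fin n))
    (F : Set (Sym2 (Fin n))) (M M' : Set (Fin n))
    (π : Equiv.Perm (Fin n)) (i : ℕ) (st : MISState n) : Prop where
  dead : ∀ v, i ≤ (π.symm v : ℕ) → v ∉ st.verts → v ∉ M ∧ v ∉ M'
  decided : ∀ v, i ≤ (π.symm v : ℕ) → v ∈ st.verts → v ∉ st.uV → v ∉ X ∧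
    ∀ u, (π.symm u : ℕ) < i → s(u, v) ∈ E → u ∉ M ∧ (s(u, v) ∉ F → u ∉ M')
  edges : ∀ u ∈ st.verts, ∀ v ∈ st.verts, (s(u, v) ∈ st.edges ↔ s(u, v) ∈ E)
  undecidedEdges : ∀ u ∈ st.verts, ∀ v ∈ st.verts, (s(u, v) ∈ st.uE ↔ s(u, v) ∈ uE)

namespace InfluenceInvariant

variable {n : ℕ} {E uE F : Set (Sym2 (Fin n))} {X : Set (Fin n)} {π : Equiv.Perm (Fin n)}
  {st : MISState n}

theorem mem_of_decided {M M' : Set (Fin n)}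
    (hM : ∀ v, v ∈ M ↔ ∀ u, π.symm u < π.symm v → s(u, v) ∈ E → u ∉ M)
    (hM' : ∀ v, v ∈ M' ↔ v ∉ X ∧ ∀ u, π.symm u < π.symm v → s(u, v) ∈ E \ F → u ∉ M')
    {u : Fin n} (h : InfluenceInvariant E uE X F M M' π (π.symm u) st)
    (hu : u ∈ st.verts) (hu' : u ∉ st.uV) : u ∈ M ∧ u ∈ M' := by
  obtain ⟨hX, hN⟩ := h.decided u le_rfl hu hu'
  exact ⟨(hM u).2 fun w hw he => (hN w hw he).1,
    (hM' u).2 ⟨hX, fun w hw he => (hN w hw he.1).2 he.2⟩⟩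

theorem step {M M' : Set (Fin n)} (hF : F ⊆ uE)
    (hM : ∀ v, v ∈ M ↔ ∀ u, π.symm u < π.symm v → s(u, v) ∈ E → u ∉ M)
    (hM' : ∀ v, v ∈ M' ↔ v ∉ X ∧ ∀ u, π.symm u < π.symm v → s(u, v) ∈ E \ F → u ∉ M')
    {u : Fin n} (h : InfluenceInvariant E uE X F M M' π (π.symm u) st) :
    InfluenceInvariant E uE X F M M' π (π.symm u + 1) (stepInf st u) := by
  have pos_cases : ∀ w, (π.symm w : ℕ) < π.symm u + 1 → w = u ∨ (π.symm w : ℕ) < π.symm u := by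
    intro w hw
    rcases (Nat.lt_succ_iff_lt_or_eq.1 hw) with h | h
    · exact .inr h
    · exact .inl (π.symm.injective (Fin.ext h))
  have ne_of_pos : ∀ v, (π.symm u : ℕ) + 1 ≤ π.symm v → v ≠ u := by
    rintro v hv rfl
    omega
  have hd := h.dead
  have hdec := h.decided
  have he := h.edges
  have hue := h.undecidedEdges
  by_cases hu : u ∈ st.verts
  · by_cases hu' : u ∈ st.uV
    · rw [stepInf, if_neg (not_not.2 hu), if_pos hu']
      constructor <;> simp only [MISState.nbrs, mem_erase, mem_union, mem_filter, Sym2.mem_iff]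
      · grind
      · intro v hv hv1 hv2
        have hvu := ne_of_pos v hv
        refine ⟨(hdec v (by omega) hv1.2 (by tauto)).1, fun w hw hwe => ?_⟩
        rcases pos_cases w hw with rfl | hw
        · have := he w hu v hv1.2
          tauto
        · exact (hdec v (by omega) hv1.2 (by tauto)).2 w hw hwe
      · grind
      · grind
    · obtain ⟨huM, huM'⟩ := h.mem_of_decided hM hM' hu hu'
      rw [stepInf, if_neg (not_not.2 hu), if_neg hu']
      constructor <;> simp only [MISState.nbrs, mem_erase, mem_sdiff, mem_union, mem_filter,
        Sym2.mem_iff]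
      · intro v hv hv1
        have hvu := ne_of_pos v hv
        have hlt : π.symm u < π.symm v := hv
        by_cases hvv : v ∈ st.verts
        · have hs : s(u, v) ∈ st.edges ∧ s(u, v) ∉ st.uE := by tauto
          rw [he u hu v hvv, hue u hu v hvv] at hs
          exact ⟨fun hvM => (hM v).1 hvM u hlt hs.1 huM,
            fun hvM => ((hM' v).1 hvM).2 u hlt ⟨hs.1, fun hf => hs.2 (hF hf)⟩ huM'⟩
        · exact hd v (by omega) hvv
      · intro v hv hv1 hv2
        have hvu := ne_of_pos v hv
        have hvU : v ∉ st.uV := by tauto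
        refine ⟨(hdec v (by omega) hv1.1.2 hvU).1, fun w hw hwe => ?_⟩
        rcases pos_cases w hw with rfl | hw
        · have := he w hu v hv1.1.2
          tauto
        · exact (hdec v (by omega) hv1.1.2 hvU).2 w hw hwe
      · grind
      · grind
  · rw [stepInf, if_pos hu]
    obtain ⟨huM, huM'⟩ := hd u le_rfl hu
    refine ⟨fun v hv => hd v (by omega), fun v hv hv1 hv2 => ?_, he, hue⟩
    obtain ⟨hX, hN⟩ := hdec v (by omega) hv1 hv2
    refine ⟨hX, fun w hw hwe => ?_⟩
    rcases pos_cases w hw with rfl | hw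
    · exact ⟨huM, fun _ => huM'⟩
    · exact hN w hw hwe

end InfluenceInvariant

/-- InfluenceMIS conservatively solves the influence analysis problem for LFMIS:
for any choice of deleted undecided vertices `X ⊆ V?` and deleted undecided edges
`F ⊆ E?`, the symmetric difference of the LFMIS of the resulting graph with the
LFMIS of `G` is contained in `InfluenceMIS(G, V?, E?, 1)`. -/
theorem influenceMIS_conservative {n : ℕ} (G : SimpleGraph (Fin n)) [DecidableRel G.Adj]
    (uV : Finset (Fin n)) (uE : Finset (Sym2 (Fin n))) (huE : uE ⊆ G.edgeFinset)
    (π : Equiv.Perm (Fin n))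
    (X : Finset (Fin n)) (hX : X ⊆ uV) (F : Finset (Sym2 (Fin n))) (hF : F ⊆ uE) :
    symmDiff (LFMISOn (Set.univ \ ↑X) ↑(G.edgeFinset \ F) π)
        (LFMISOn Set.univ ↑G.edgeFinset π)
      ⊆ ↑(influenceMIS π (initState G uV uE)) := by
  set E : Set (Sym2 (Fin n)) := ↑G.edgeFinset
  set M := LFMISOn Set.univ E π
  set M' := LFMISOn (Set.univ \ ↑X) ↑(G.edgeFinset \ F) π
  have hM : ∀ v, v ∈ M ↔ ∀ u, π.symm u < π.symm v → s(u, v) ∈ E → u ∉ M := fun v =>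
    (mem_LFMISOn_iff _ _ _ v).trans (by simp [M])
  have hM' : ∀ v, v ∈ M' ↔ v ∉ (X : Set (Fin n)) ∧
      ∀ u, π.symm u < π.symm v → s(u, v) ∈ E \ ↑F → u ∉ M' := fun v =>
    (mem_LFMISOn_iff _ _ _ v).trans (by simp [M', E])
  have inv : ∀ i ≤ n, InfluenceInvariant E uE X F M M' π i
      (stateAt π (initState G uV uE) i) := by
    intro i
    induction i with
    | zero =>
      intro _
      refine ⟨by simp [stateAt, initState], fun v _ _ hv => ⟨fun hvX => hv (hX hvX), ?_⟩, ?_, ?_⟩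
      · exact fun u hu => absurd hu (Nat.not_lt_zero _)
      · simp [stateAt, initState, E]
      · simp [stateAt, initState]
    | succ i ih =>
      intro hi
      have h := ih (by omega)
      rw [stateAt, dif_pos (Nat.lt_of_succ_le hi)]
      obtain ⟨u, hu⟩ : ∃ u, π.symm u = ⟨i, hi⟩ := ⟨π ⟨i, hi⟩, by simp⟩
      have hui : (π.symm u : ℕ) = i := by rw [hu]
      rw [show π ⟨i, hi⟩ = u by rw [← hu]; simp]
      subst hui
      exact h.step (by exact_mod_cast hF) hM hM'
  intro v hv
  have h := inv (π.symm v) (π.symm v).2.le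
  rw [influenceMIS, mem_coe, mem_filter]
  refine ⟨mem_univ _, ?_⟩
  by_contra hcon
  rw [Set.mem_symmDiff] at hv
  by_cases hvv : v ∈ (stateAt π (initState G uV uE) (π.symm v)).verts
  · have := h.mem_of_decided hM hM' hvv (fun hu => hcon ⟨hvv, hu⟩)
    tauto
  · have := h.dead v le_rfl hvv
    tauto
end

section
/- Fix a state (G, V^?, E^?) of InfluenceMIS at the beginning of iteration i, reachable from some initial state by a fixed prefix π[1..i) of the permutation, and draw the remainder of π uniformly at random among the permutations consistent with that prefix (so that the vertex u = π(i) processed at iteration i is uniform among the n−i+1 vertices not yet assigned a position). Let (G', V'^?, E'^?) be the state after iteration i. Then E[|V'^?| + |E'^?|] ≤ |V^?| + |E^?| − |V^?|/(n−i+1). -/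
open Finset

/-- The neighbors of `u` along decided edges. -/
def MISState.decidedNbrs {n : ℕ} (st : MISState n) (u : Fin n) : Finset (Fin n) :=
  (st.nbrs u).filter fun v => s(u, v) ∉ st.uE

/-- The neighbors of `u` along undecided edges. -/
def MISState.undecidedNbrs {n : ℕ} (st : MISState n) (u : Fin n) : Finset (Fin n) :=
  (st.nbrs u).filter fun v => s(u, v) ∈ st.uE

/-- The number of undecided vertices plus the number of undecided edges. -/
def MISState.undecidedCount {n : ℕ} (st : MISState n) : ℕ := st.uV.card + st.uE.card

/-- An upper bound for the change of `undecidedCount` caused by processing `u`. -/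
def MISState.drift {n : ℕ} (st : MISState n) (u : Fin n) : ℝ :=
  if u ∈ st.uV then ((st.decidedNbrs u \ st.uV).card : ℝ) - 1
  else if u ∈ st.verts then -((st.decidedNbrs u ∩ st.uV).card : ℝ) else 0

theorem uV_stepInf_subset {n : ℕ} {st : MISState n} (h : st.uV ⊆ st.verts) (u : Fin n) :
    (stepInf st u).uV ⊆ (stepInf st u).verts := by
  unfold stepInf
  split_ifs with hu hv
  · exact erase_subset_erase _ (union_subset h (filter_subset _ _))
  · intro v hv
    simp only [mem_erase, mem_union, MISState.nbrs, mem_filter, mem_sdiff] at hv ⊢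
    have := @h v
    grind
  · exact h

theorem uV_stateAt_subset {n : ℕ} (π : Equiv.Perm (Fin n)) {st : MISState n}
    (h : st.uV ⊆ st.verts) (i : ℕ) : (stateAt π st i).uV ⊆ (stateAt π st i).verts := by
  induction i with
  | zero => exact h
  | succ i ih =>
    rw [stateAt]
    split_ifs
    · exact uV_stepInf_subset ih _
    · exact ih

theorem stepInf_verts_subset {n : ℕ} (st : MISState n) (u : Fin n) :
    (stepInf st u).verts ⊆ st.verts.erase u := by
  unfold stepInf
  split_ifs with hu hv
  · exact Subset.rfl
  · exact sdiff_subset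
  · rw [erase_eq_of_notMem hu]

theorem notMem_verts_stateAt {n : ℕ} (π : Equiv.Perm (Fin n)) (st : MISState n) (i : ℕ)
    (j : Fin n) (hj : (j : ℕ) < i) : π j ∉ (stateAt π st i).verts := by
  induction i with
  | zero => omega
  | succ i ih =>
    rw [stateAt]
    split_ifs with hi
    · intro h
      have h' := mem_erase.1 (stepInf_verts_subset _ _ h)
      rcases Nat.lt_succ_iff_lt_or_eq.1 hj with hj | rfl
      · exact ih hj h'.2
      · exact h'.1 rfl
    · exact ih (by omega)

theorem stateAt_congr {n : ℕ} {π σ : Equiv.Perm (Fin n)} (st : MISState n) (i : ℕ)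
    (h : ∀ j : Fin n, (j : ℕ) < i → π j = σ j) : stateAt π st i = stateAt σ st i := by
  induction i with
  | zero => rfl
  | succ i ih =>
    rw [stateAt, stateAt, ih fun j hj => h j (by omega)]
    split_ifs with hi
    · rw [h ⟨i, hi⟩ (Nat.lt_succ_self i)]
    · rfl

theorem card_add_card_undecidedNbrs_le {n : ℕ} (st : MISState n) (u : Fin n)
    (F : Finset (Sym2 (Fin n))) (hF : F ⊆ st.uE) (hu : ∀ e ∈ F, u ∉ e) :
    F.card + (st.undecidedNbrs u).card ≤ st.uE.card := by
  have hinj : Function.Injective fun v => s(u, v) := fun a b hab => Sym2.congr_right.1 hab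
  rw [← card_image_of_injective (st.undecidedNbrs u) hinj, ← card_union_of_disjoint]
  · refine card_le_card (union_subset hF ?_)
    intro e he
    obtain ⟨v, hv, rfl⟩ := mem_image.1 he
    exact (mem_filter.1 hv).2
  · rw [disjoint_left]
    intro e he he'
    obtain ⟨v, hv, rfl⟩ := mem_image.1 he'
    exact hu _ he (Sym2.mem_mk_left u v)

theorem nbrs_eq_union {n : ℕ} (st : MISState n) (u : Fin n) :
    st.nbrs u = st.decidedNbrs u ∪ st.undecidedNbrs u := by
  rw [union_comm]
  exact (filter_union_filter_not_eq _ _).symm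

theorem drift_eq_zero {n : ℕ} {st : MISState n} (h : st.uV ⊆ st.verts) {u : Fin n}
    (hu : u ∉ st.verts) : st.drift u = 0 := by
  rw [MISState.drift, if_neg fun hv => hu (h hv), if_neg hu]

theorem undecidedCount_stepInf_le {n : ℕ} {st : MISState n} (h : st.uV ⊆ st.verts)
    (u : Fin n) :
    ((stepInf st u).undecidedCount : ℝ) ≤ st.undecidedCount + st.drift u := by
  have hdrift : st.drift u = if u ∈ st.uV then ((st.decidedNbrs u \ st.uV).card : ℝ) - 1
    else if u ∈ st.verts then -((st.decidedNbrs u ∩ st.uV).card : ℝ) else 0 := rfl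
  unfold stepInf
  split_ifs with hu hv
  · have hE := card_add_card_undecidedNbrs_le st u (st.uE.filter fun e => u ∉ e)
      (filter_subset _ _) fun e he => (mem_filter.1 he).2
    have hV : ((st.uV ∪ st.nbrs u).erase u).card + 1 ≤
        st.uV.card + (st.decidedNbrs u \ st.uV).card + (st.undecidedNbrs u).card := by
      rw [card_erase_add_one (mem_union_left _ hv), nbrs_eq_union]
      calc (st.uV ∪ (st.decidedNbrs u ∪ st.undecidedNbrs u)).card
          = ((st.uV ∪ st.decidedNbrs u \ st.uV) ∪ st.undecidedNbrs u).card := by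
            rw [union_sdiff_self_eq_union, union_assoc]
        _ ≤ _ := (card_union_le _ _).trans (Nat.add_le_add_right (card_union_le _ _) _)
    have : ((st.uV ∪ st.nbrs u).erase u).card + (st.uE.filter fun e => u ∉ e).card + 1 ≤
        st.uV.card + st.uE.card + (st.decidedNbrs u \ st.uV).card := by omega
    rw [hdrift, if_pos hv]
    simp only [MISState.undecidedCount]
    have := (Nat.cast_le (α := ℝ)).2 this
    push_cast at this ⊢
    linarith
  · have hE := card_add_card_undecidedNbrs_le st u
      (st.uE.filter fun e => u ∉ e ∧ ∀ v ∈ st.decidedNbrs u, v ∉ e)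
      (filter_subset _ _) fun e he => (mem_filter.1 he).2.1
    have hV : (((st.uV ∪ st.undecidedNbrs u) \ st.decidedNbrs u).erase u).card +
        (st.decidedNbrs u ∩ st.uV).card ≤ st.uV.card + (st.undecidedNbrs u).card := by
      calc _ ≤ ((st.uV \ st.decidedNbrs u) ∪ st.undecidedNbrs u).card +
            (st.uV ∩ st.decidedNbrs u).card := by
            rw [inter_comm]
            gcongr
            refine (erase_subset _ _).trans ?_
            rw [union_sdiff_distrib]
            exact union_subset_union_right sdiff_subset
        _ ≤ (st.uV \ st.decidedNbrs u).card + (st.undecidedNbrs u).card +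
            (st.uV ∩ st.decidedNbrs u).card := by
            gcongr
            exact card_union_le _ _
        _ = _ := by
            have := card_sdiff_add_card_inter st.uV (st.decidedNbrs u)
            omega
    have : (((st.uV ∪ st.undecidedNbrs u) \ st.decidedNbrs u).erase u).card +
        (st.uE.filter fun e => u ∉ e ∧ ∀ v ∈ st.decidedNbrs u, v ∉ e).card +
        (st.decidedNbrs u ∩ st.uV).card ≤ st.uV.card + st.uE.card := by omega
    rw [hdrift, if_neg hv, if_pos hu]
    have := (Nat.cast_le (α := ℝ)).2 this
    change (((((st.uV ∪ st.undecidedNbrs u) \ st.decidedNbrs u).erase u).card +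
      (st.uE.filter fun e => u ∉ e ∧ ∀ v ∈ st.decidedNbrs u, v ∉ e).card : ℕ) : ℝ) ≤
      ((st.uV.card + st.uE.card : ℕ) : ℝ) + _
    push_cast at this ⊢
    linarith
  · rw [drift_eq_zero h hu, add_zero]

theorem mem_decidedNbrs_comm {n : ℕ} {st : MISState n} {u v : Fin n}
    (hu : u ∈ st.verts) (hv : v ∈ st.verts) :
    v ∈ st.decidedNbrs u ↔ u ∈ st.decidedNbrs v := by
  simp only [MISState.decidedNbrs, MISState.nbrs, mem_filter, hu, hv, true_and,
    Sym2.eq_swap (a := u) (b := v), ne_comm (a := u) (b := v)]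

theorem sum_drift {n : ℕ} {st : MISState n} (h : st.uV ⊆ st.verts) :
    ∑ u, st.drift u = -(st.uV.card : ℝ) := by
  have hcount : ∑ u ∈ st.uV, (st.decidedNbrs u \ st.uV).card =
      ∑ v ∈ st.verts \ st.uV, (st.decidedNbrs v ∩ st.uV).card := by
    have := sum_card_bipartiteAbove_eq_sum_card_bipartiteBelow
      (s := st.uV) (t := st.verts \ st.uV) fun u v => v ∈ st.decidedNbrs u
    convert this using 3 with u hu v hv
    · ext v
      have hsub : v ∈ st.decidedNbrs u → v ∈ st.verts := fun hv =>
        (mem_filter.1 (mem_filter.1 hv).1).1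
      simp only [mem_sdiff, mem_bipartiteAbove]
      tauto
    · ext u
      simp only [mem_inter, mem_bipartiteBelow]
      constructor
      · rintro ⟨h1, h2⟩
        exact ⟨h2, (mem_decidedNbrs_comm (mem_sdiff.1 hv).1 (h h2)).1 h1⟩
      · rintro ⟨h2, h1⟩
        exact ⟨(mem_decidedNbrs_comm (mem_sdiff.1 hv).1 (h h2)).2 h1, h2⟩
  have hverts : ∑ u, st.drift u = ∑ u ∈ st.verts, st.drift u :=
    (sum_subset (subset_univ _) fun u _ hu => drift_eq_zero h hu).symm
  have h1 : ∑ u ∈ st.uV, st.drift u =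
      ∑ u ∈ st.uV, ((st.decidedNbrs u \ st.uV).card : ℝ) - st.uV.card := by
    rw [sum_congr rfl fun u hu => show st.drift u = _ from if_pos hu]
    simp [sum_sub_distrib]
  have h2 : ∑ u ∈ st.verts \ st.uV, st.drift u =
      -∑ u ∈ st.verts \ st.uV, ((st.decidedNbrs u ∩ st.uV).card : ℝ) := by
    rw [← sum_neg_distrib]
    refine sum_congr rfl fun u hu => ?_
    rw [MISState.drift, if_neg (mem_sdiff.1 hu).2, if_pos (mem_sdiff.1 hu).1]
  have hcount' := congrArg (Nat.cast (R := ℝ)) hcount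
  push_cast at hcount'
  rw [hverts, ← sum_sdiff h, h1, h2]
  linarith

theorem card_filter_le_val {n k : ℕ} (hk : k ≤ n) :
    (univ.filter fun j : Fin n => k ≤ (j : ℕ)).card = n - k := by
  have h1 := card_filter_add_card_filter_not (s := (univ : Finset (Fin n)))
    fun j : Fin n => (j : ℕ) < k
  have h2 := Fin.card_filter_val_lt (n := n) (m := k)
  simp only [not_lt, card_univ, Fintype.card_fin] at h1
  omega

/-- Summing over all possible choices of the next vertex. -/
theorem sum_undecidedCount_stepInf_le {n : ℕ} {st : MISState n} (h : st.uV ⊆ st.verts)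
    (π : Equiv.Perm (Fin n)) {k : ℕ} (hk : k ≤ n)
    (hπ : ∀ j : Fin n, (j : ℕ) < k → π j ∉ st.verts) :
    ∑ j ∈ univ.filter (fun j : Fin n => k ≤ (j : ℕ)),
        ((stepInf st (π j)).undecidedCount : ℝ) ≤
      ((n : ℝ) - k) * st.undecidedCount - st.uV.card := by
  calc _ ≤ ∑ j ∈ univ.filter (fun j : Fin n => k ≤ (j : ℕ)),
        ((st.undecidedCount : ℝ) + st.drift (π j)) :=
        sum_le_sum fun j _ => undecidedCount_stepInf_le h (π j)
    _ = ((n : ℝ) - k) * st.undecidedCount + ∑ j, st.drift (π j) := by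
        rw [sum_add_distrib, sum_const, card_filter_le_val hk, nsmul_eq_mul, Nat.cast_sub hk]
        congr 1
        refine sum_subset (subset_univ _) fun j _ hj => drift_eq_zero h (hπ j ?_)
        simpa using hj
    _ = _ := by
        rw [Equiv.sum_comp π st.drift, sum_drift h, ← sub_eq_add_neg]

/-- Given a fixed prefix of length `k`, all positions from `k` on are identically distributed. -/
theorem sum_perm_prefix_eq {n k : ℕ} (π₀ : Equiv.Perm (Fin n)) (f : Fin n → ℝ) {i j : Fin n}
    (hi : k ≤ (i : ℕ)) (hj : k ≤ (j : ℕ)) :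
    ∑ π ∈ univ.filter
        (fun π : Equiv.Perm (Fin n) => ∀ j : Fin n, (j : ℕ) < k → π j = π₀ j), f (π i) =
      ∑ π ∈ univ.filter
        (fun π : Equiv.Perm (Fin n) => ∀ j : Fin n, (j : ℕ) < k → π j = π₀ j), f (π j) := by
  refine sum_equiv (Equiv.mulRight (Equiv.swap i j)) (fun π => ?_) fun π _ => ?_
  · simp only [mem_filter, mem_univ, true_and, Equiv.coe_mulRight]
    refine forall₂_congr fun l hl => ?_
    rw [Equiv.Perm.mul_apply, Equiv.swap_apply_of_ne_of_ne]
    · rintro rfl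
      omega
    · rintro rfl
      omega
  · simp

/-- One step of InfluenceMIS shrinks the expected number of undecided vertices
plus undecided edges by at least `|V?|/(n-i+1)`: conditioned on a fixed prefix
`π[1..i)` (0-based: the first `k` positions agree with `π₀`), the state `st` at
the beginning of iteration `i` is determined, the vertex processed at iteration
`i` is uniform among the `n-k = n-i+1` unplaced vertices, and the expected value
of `|V'?| + |E'?|` after the iteration is at most `|V?| + |E?| - |V?|/(n-i+1)`. -/
theorem expected_undecided_decrease {n : ℕ} (G : SimpleGraph (Fin n)) [DecidableRel G.Adj]
    (uV : Finset (Fin n)) (uE : Finset (Sym2 (Fin n))) (huE : uE ⊆ G.edgeFinset)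
    (π₀ : Equiv.Perm (Fin n)) (k : ℕ) (hk : k < n) :
    (∑ π ∈ Finset.univ.filter
        (fun π : Equiv.Perm (Fin n) => ∀ j : Fin n, (j : ℕ) < k → π j = π₀ j),
        (((stateAt π (initState G uV uE) (k + 1)).uV.card : ℝ) +
          ((stateAt π (initState G uV uE) (k + 1)).uE.card : ℝ)))
      ≤ ((Finset.univ.filter
          (fun π : Equiv.Perm (Fin n) => ∀ j : Fin n, (j : ℕ) < k → π j = π₀ j)).card : ℝ) *
        (((stateAt π₀ (initState G uV uE) k).uV.card : ℝ) +
          ((stateAt π₀ (initState G uV uE) k).uE.card : ℝ) -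
          ((stateAt π₀ (initState G uV uE) k).uV.card : ℝ) / ((n : ℝ) - (k : ℝ))) := by
  set st := stateAt π₀ (initState G uV uE) k with hst
  set S := Finset.univ.filter
    (fun π : Equiv.Perm (Fin n) => ∀ j : Fin n, (j : ℕ) < k → π j = π₀ j) with hS
  have hsub : st.uV ⊆ st.verts := uV_stateAt_subset π₀ (subset_univ _) k
  have hpos : (0 : ℝ) < (n : ℝ) - k := sub_pos.2 (Nat.cast_lt.2 hk)
  have hstep : ∀ π ∈ S, ((stateAt π (initState G uV uE) (k + 1)).uV.card : ℝ) +
      ((stateAt π (initState G uV uE) (k + 1)).uE.card : ℝ) =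
      (stepInf st (π ⟨k, hk⟩)).undecidedCount := by
    intro π hπ
    rw [stateAt, dif_pos hk, stateAt_congr _ k (mem_filter.1 hπ).2, MISState.undecidedCount,
      Nat.cast_add]
  rw [sum_congr rfl hstep]
  refine le_of_mul_le_mul_left ?_ hpos
  calc ((n : ℝ) - k) * ∑ π ∈ S, ((stepInf st (π ⟨k, hk⟩)).undecidedCount : ℝ)
      = ∑ j ∈ univ.filter (fun j : Fin n => k ≤ (j : ℕ)),
          ∑ π ∈ S, ((stepInf st (π j)).undecidedCount : ℝ) := by
        rw [sum_congr rfl fun j hj => sum_perm_prefix_eq π₀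
          (fun u => ((stepInf st u).undecidedCount : ℝ)) (mem_filter.1 hj).2
          (le_refl ((⟨k, hk⟩ : Fin n) : ℕ)), sum_const, card_filter_le_val hk.le, nsmul_eq_mul,
          Nat.cast_sub hk.le]
    _ = ∑ π ∈ S, ∑ j ∈ univ.filter (fun j : Fin n => k ≤ (j : ℕ)),
          ((stepInf st (π j)).undecidedCount : ℝ) := sum_comm
    _ ≤ ∑ _π ∈ S, (((n : ℝ) - k) * st.undecidedCount - st.uV.card) := by
        refine sum_le_sum fun π hπ => sum_undecidedCount_stepInf_le hsub π hk.le fun j hj => ?_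
        rw [(mem_filter.1 hπ).2 j hj]
        exact notMem_verts_stateAt π₀ _ k j hj
    _ = _ := by
        rw [sum_const, nsmul_eq_mul, MISState.undecidedCount, Nat.cast_add]
        field_simp
end

section
/- Let G=(V,E) be a finite simple graph, let E_+ be a set of non-edges of G, and run InfluenceMIS on the graph G_all = (V, E ∪ E_+) with initial undecided vertex set V_1^? = ∅ and initial undecided edge set E_1^? ⊆ E ∪ E_+ satisfying E_+ ⊆ E_1^?. If u = π(i) ∈ LFMIS(G,π) and u ∈ V_j^? for some j < i, then u ∈ V_i^?. -/
open Finset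

/-- Membership in the greedy MIS of a graph on all of `Fin n`: no earlier neighbor is a member. -/
theorem lfmisAux_symm_iff {n : ℕ} (E : Set (Sym2 (Fin n))) (π : Equiv.Perm (Fin n)) (v : Fin n) :
    lfmisAux Set.univ E π (π.symm v : ℕ) ↔
      ∀ w, π.symm w < π.symm v → s(w, v) ∈ E → ¬ lfmisAux Set.univ E π (π.symm w : ℕ) := by
  rw [lfmisAux]
  constructor
  · rintro ⟨-, h⟩ w hw he
    exact h _ hw ⟨(π.symm w).2, (π.symm v).2, trivial, trivial, by simpa using he⟩
  · refine fun h => ⟨⟨(π.symm v).2, trivial⟩, ?_⟩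
    rintro j hj ⟨hjn, _, -, -, he⟩
    simpa using h (π ⟨j, hjn⟩) (by simpa [Fin.lt_def] using hj) (by simpa using he)

/-- The invariant of `InfluenceMIS` at the beginning of iteration `t`, where the decided graph has
edge set `E`, the full graph has edge set `A`, and the undecided edges are initially `F`. -/
structure InfluenceInvariant_s6 {n : ℕ} (E A F : Finset (Sym2 (Fin n))) (π : Equiv.Perm (Fin n))
    (t : ℕ) (st : MISState n) : Prop where
  edges_subset : st.edges ⊆ A
  uE_of_mem : ∀ e ∈ st.edges, e ∈ F → e ∈ st.uE
  edge_of_mem : ∀ v ∈ st.verts, ∀ w ∈ st.verts, s(v, w) ∈ A → s(v, w) ∈ st.edges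
  mem_verts : ∀ v, t ≤ (π.symm v : ℕ) → lfmisAux Set.univ (E : Set (Sym2 (Fin n))) π (π.symm v) →
    v ∈ st.verts
  mem_uV : ∀ v, (π.symm v : ℕ) < t → lfmisAux Set.univ (E : Set (Sym2 (Fin n))) π (π.symm v) →
    ∀ w ∈ st.verts, s(v, w) ∈ E → w ∈ st.uV

namespace InfluenceInvariant_s6

variable {n : ℕ} {E A F : Finset (Sym2 (Fin n))} {π : Equiv.Perm (Fin n)} {t : ℕ}
  {st : MISState n}

/-- An alive, decided vertex belongs to the greedy MIS when it is processed. -/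
theorem lfmisAux_of_decided (h : InfluenceInvariant_s6 E A F π t st) {u : Fin n}
    (ht : (π.symm u : ℕ) = t) (hu : u ∈ st.verts) (hd : u ∉ st.uV) :
    lfmisAux Set.univ (E : Set (Sym2 (Fin n))) π (π.symm u) := by
  rw [lfmisAux_symm_iff]
  intro w hw he hM
  exact hd (h.mem_uV w (by rw [← ht]; exact hw) hM u hu (by simpa using he))

/-- A later member of the greedy MIS is joined to an alive, decided vertex only by undecided
edges. -/
theorem mem_uE_of_lfmisAux (h : InfluenceInvariant_s6 E A F π t st) (hA : A ⊆ E ∪ F) {u v : Fin n}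
    (ht : (π.symm u : ℕ) = t) (hu : u ∈ st.verts) (hd : u ∉ st.uV)
    (hv : t < (π.symm v : ℕ)) (hM : lfmisAux Set.univ (E : Set (Sym2 (Fin n))) π (π.symm v))
    (he : s(u, v) ∈ st.edges) : s(u, v) ∈ st.uE := by
  rcases mem_union.1 (hA (h.edges_subset he)) with hE | hF
  · rw [lfmisAux_symm_iff] at hM
    exact absurd (h.lfmisAux_of_decided ht hu hd) (hM u (by rw [Fin.lt_def, ht]; exact hv) hE)
  · exact h.uE_of_mem _ he hF

/-- A later member of the greedy MIS stays undecided during one iteration. -/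
theorem mem_uV_stepInf (h : InfluenceInvariant_s6 E A F π t st) (hA : A ⊆ E ∪ F) {u v : Fin n}
    (ht : (π.symm u : ℕ) = t) (hv : t < (π.symm v : ℕ))
    (hM : lfmisAux Set.univ (E : Set (Sym2 (Fin n))) π (π.symm v)) (hvU : v ∈ st.uV) :
    v ∈ (stepInf st u).uV := by
  have hne : v ≠ u := by rintro rfl; omega
  unfold stepInf
  split_ifs with hu hd
  · simp [hne, hvU]
  · have := fun hu => h.mem_uE_of_lfmisAux hA ht hu hd hv hM
    simp only [MISState.nbrs, mem_erase, mem_sdiff, mem_union, mem_filter]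
    tauto
  · exact hvU

theorem step_s6 (h : InfluenceInvariant_s6 E A F π t st) (hA : A ⊆ E ∪ F) (hE : E ⊆ A)
    (hdiag : ∀ e ∈ E, ¬ e.IsDiag) {u : Fin n} (ht : (π.symm u : ℕ) = t) :
    InfluenceInvariant_s6 E A F π (t + 1) (stepInf st u) := by
  have eq_u : ∀ v, (π.symm v : ℕ) < t + 1 → ¬ (π.symm v : ℕ) < t → v = u := by
    intro v h1 h2
    exact π.symm.injective (Fin.ext (by omega))
  have hne : ∀ w, s(u, w) ∈ E → w ≠ u := by
    rintro w hw rfl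
    exact hdiag _ hw (by simp)
  have hnu : ∀ v, t + 1 ≤ (π.symm v : ℕ) → v ≠ u := by
    rintro v hv rfl
    omega
  unfold stepInf
  split_ifs with hu hd
  · refine ⟨(filter_subset _ _).trans h.edges_subset, ?_, ?_, ?_, ?_⟩
    · simp only [mem_filter]
      exact fun e he hF => ⟨h.uE_of_mem e he.1 hF, he.2⟩
    · simp only [mem_filter, mem_erase, Sym2.mem_iff]
      rintro v hv w hw he
      exact ⟨h.edge_of_mem v hv.2 w hw.2 he, by rintro (rfl | rfl) <;> tauto⟩
    · simp only [mem_erase]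
      exact fun v hv hM => ⟨hnu v hv, h.mem_verts v (by omega) hM⟩
    · simp only [mem_erase, mem_union, MISState.nbrs, mem_filter]
      intro v hv hM w hw he
      refine ⟨hw.1, ?_⟩
      by_cases hvt : (π.symm v : ℕ) < t
      · exact Or.inl (h.mem_uV v hvt hM w hw.2 he)
      · obtain rfl := eq_u v hv hvt
        exact Or.inr ⟨hw.2, hw.1, h.edge_of_mem _ hu _ hw.2 (hE he)⟩
  · refine ⟨(filter_subset _ _).trans h.edges_subset, ?_, ?_, ?_, ?_⟩
    · simp only [mem_filter]
      exact fun e he hF => ⟨h.uE_of_mem e he.1 hF, he.2⟩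
    · simp only [mem_filter, mem_erase, mem_sdiff, Sym2.mem_iff]
      rintro v ⟨hv, hvD⟩ w ⟨hw, hwD⟩ he
      refine ⟨h.edge_of_mem v hv.2 w hw.2 he, by rintro (rfl | rfl) <;> tauto, ?_⟩
      rintro x hx (rfl | rfl)
      · exact hvD hx
      · exact hwD hx
    · simp only [mem_erase, mem_sdiff, MISState.nbrs, mem_filter]
      intro v hv hM
      have := h.mem_uE_of_lfmisAux hA ht hu hd (by omega) hM
      exact ⟨⟨hnu v hv, h.mem_verts v (by omega) hM⟩, by tauto⟩
    · simp only [mem_erase, mem_sdiff, mem_union, MISState.nbrs, mem_filter]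
      intro v hv hM w hw he
      refine ⟨hw.1.1, ?_, hw.2⟩
      by_cases hvt : (π.symm v : ℕ) < t
      · exact Or.inl (h.mem_uV v hvt hM w hw.1.2 he)
      · obtain rfl := eq_u v hv hvt
        have := h.edge_of_mem _ hu _ hw.1.2 (hE he)
        tauto
  · refine ⟨h.edges_subset, h.uE_of_mem, h.edge_of_mem,
      fun v hv => h.mem_verts v (by omega), ?_⟩
    intro v hv hM
    by_cases hvt : (π.symm v : ℕ) < t
    · exact h.mem_uV v hvt hM
    · obtain rfl := eq_u v hv hvt
      exact absurd (h.mem_verts _ ht.ge hM) hu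

/-- The invariant holds at the beginning of every iteration of a run started with no undecided
vertices. -/
theorem stateAt (hA : A ⊆ E ∪ F) (hE : E ⊆ A) (hdiag : ∀ e ∈ E, ¬ e.IsDiag) :
    ∀ t ≤ n, InfluenceInvariant_s6 E A F π t (_root_.stateAt π ⟨Finset.univ, A, ∅, F⟩ t)
  | 0, _ => ⟨Subset.rfl, fun _ _ h => h, fun _ _ _ _ h => h, fun _ _ _ => mem_univ _,
      fun _ h => absurd h (Nat.not_lt_zero _)⟩
  | t + 1, ht => by
    rw [_root_.stateAt, dif_pos (by omega : t < n)]
    exact (InfluenceInvariant_s6.stateAt hA hE hdiag t (by omega)).step_s6 hA hE hdiag (by simp)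

end InfluenceInvariant_s6

/-- Run `InfluenceMIS` on `G_all = (V, E ∪ E₊)` (where `E₊` is a set of non-edges
of `G`) with no undecided vertices and with undecided edges `uE ⊇ E₊`.  If the
vertex `u = π(i)` is in `LFMIS(G, π)` and `u` was undecided at the beginning of
some iteration `j < i`, then `u` is still undecided at the beginning of
iteration `i`.  (0-based iterations.) -/
theorem lfmis_member_stays_undecided {n : ℕ} (G : SimpleGraph (Fin n)) [DecidableRel G.Adj]
    (Eplus : Finset (Sym2 (Fin n)))
    (hEp : ∀ e ∈ Eplus, ¬ e.IsDiag ∧ e ∉ G.edgeFinset)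
    (uE : Finset (Sym2 (Fin n))) (h1 : Eplus ⊆ uE) (h2 : uE ⊆ G.edgeFinset ∪ Eplus)
    (π : Equiv.Perm (Fin n)) (i : ℕ) (hi : i < n) (j : ℕ) (hj : j < i)
    (hmem : π ⟨i, hi⟩ ∈ LFMISOn Set.univ ↑G.edgeFinset π)
    (hu : π ⟨i, hi⟩ ∈ (stateAt π ⟨Finset.univ, G.edgeFinset ∪ Eplus, ∅, uE⟩ j).uV) :
    π ⟨i, hi⟩ ∈ (stateAt π ⟨Finset.univ, G.edgeFinset ∪ Eplus, ∅, uE⟩ i).uV := by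
  have hA : G.edgeFinset ∪ Eplus ⊆ G.edgeFinset ∪ uE := union_subset_union_right h1
  have hdiag : ∀ e ∈ G.edgeFinset, ¬ e.IsDiag := fun e he =>
    G.not_isDiag_of_mem_edgeSet (SimpleGraph.mem_edgeFinset.1 he)
  have stays : ∀ k, j ≤ k → k ≤ i →
      π ⟨i, hi⟩ ∈ (stateAt π ⟨Finset.univ, G.edgeFinset ∪ Eplus, ∅, uE⟩ k).uV := by
    intro k hk
    induction k, hk using Nat.le_induction with
    | base => exact fun _ => hu
    | succ k hk ih =>
      intro hki
      rw [stateAt, dif_pos (by omega : k < n)]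
      exact (InfluenceInvariant_s6.stateAt hA subset_union_left hdiag k (by omega)).mem_uV_stepInf hA
        (by simp) (by simpa using hki) hmem.2 (ih (by omega))
  exact stays i hj.le le_rfl
end

section
/- Let G=(V,E) be a finite simple graph, let E_+ be a set of non-edges of G, let E_- ⊆ E, and set E_new = (E ∪ E_+) \ E_-. Then for every permutation π of V: LFMIS((V,E),π) △ LFMIS((V,E_new),π) ⊆ InfluenceMIS((V, E ∪ E_+), ∅, E_+ ∪ E_-, 1), where △ denotes symmetric difference of vertex sets. -/
open Finset

/-- The bookkeeping facts that hold at the beginning of iteration `i` of `InfluenceMIS`: edges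
between alive vertices are untouched, a vertex deleted before its own iteration has an earlier
alive decided neighbor along a decided edge, and an alive decided vertex has no neighbor that was
alive at its own, earlier iteration. -/
structure InfluenceInvariant_s7 {n : ℕ} (π : Equiv.Perm (Fin n)) (st0 : MISState n) (i : ℕ) :
    Prop where
  edges_iff : ∀ u ∈ (stateAt π st0 i).verts, ∀ v ∈ (stateAt π st0 i).verts,
    (s(u, v) ∈ (stateAt π st0 i).edges ↔ s(u, v) ∈ st0.edges) ∧
      (s(u, v) ∈ (stateAt π st0 i).uE ↔ s(u, v) ∈ st0.uE)
  exists_of_dead : ∀ v, i ≤ (π.symm v : ℕ) → v ∉ (stateAt π st0 i).verts →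
    ∃ j : Fin n, (j : ℕ) < i ∧ π j ∈ (stateAt π st0 j).verts ∧ π j ∉ (stateAt π st0 j).uV ∧
      s(π j, v) ∈ st0.edges ∧ s(π j, v) ∉ st0.uE
  dead_of_decided : ∀ v ∈ (stateAt π st0 i).verts, v ∉ (stateAt π st0 i).uV →
    ∀ j : Fin n, (j : ℕ) < i → s(π j, v) ∈ st0.edges → π j ∉ (stateAt π st0 j).verts

section stepInf

variable {n : ℕ} {st : MISState n} {u v w : Fin n}

lemma verts_stepInf_subset : (stepInf st u).verts ⊆ st.verts := by
  intro v
  unfold stepInf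
  split_ifs <;> simp +contextual

lemma notMem_verts_stepInf : u ∉ (stepInf st u).verts := by
  unfold stepInf
  split_ifs <;> simp_all

lemma mem_edges_stepInf (hv : v ∈ (stepInf st u).verts) (hw : w ∈ (stepInf st u).verts) :
    (s(v, w) ∈ (stepInf st u).edges ↔ s(v, w) ∈ st.edges) ∧
      (s(v, w) ∈ (stepInf st u).uE ↔ s(v, w) ∈ st.uE) := by
  unfold stepInf at *
  split_ifs at * <;> grind

lemma of_mem_verts_of_notMem_verts_stepInf (hv : v ∈ st.verts) (hvu : v ≠ u)
    (h : v ∉ (stepInf st u).verts) :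
    u ∈ st.verts ∧ u ∉ st.uV ∧ s(u, v) ∈ st.edges ∧ s(u, v) ∉ st.uE := by
  unfold stepInf at h
  split_ifs at h <;> grind [MISState.nbrs]

lemma notMem_uV_of_stepInf (hv : v ∈ (stepInf st u).verts) (h : v ∉ (stepInf st u).uV) :
    v ∉ st.uV ∧ (u ∈ st.verts → s(u, v) ∉ st.edges) := by
  unfold stepInf at *
  split_ifs at * <;> grind [MISState.nbrs]

end stepInf

lemma influenceInvariant {n : ℕ} (π : Equiv.Perm (Fin n)) {st0 : MISState n}
    (h0 : st0.verts = Finset.univ) : ∀ i, i ≤ n → InfluenceInvariant_s7 π st0 i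
  | 0, _ => ⟨by simp [stateAt], by simp [stateAt, h0], by simp⟩
  | i + 1, hi => by
    have hin : i < n := hi
    have ih := influenceInvariant π h0 i hin.le
    have hs : stateAt π st0 (i + 1) = stepInf (stateAt π st0 i) (π ⟨i, hin⟩) := by
      simp [stateAt, hin]
    refine ⟨fun u hu v hv => ?_, fun v hv hd => ?_, fun v hv hd j hj he => ?_⟩
    · rw [hs] at hu hv ⊢
      have h1 := mem_edges_stepInf hu hv
      have h2 := ih.edges_iff u (verts_stepInf_subset hu) v (verts_stepInf_subset hv)
      exact ⟨h1.1.trans h2.1, h1.2.trans h2.2⟩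
    · rw [hs] at hd
      by_cases hvi : v ∈ (stateAt π st0 i).verts
      · have hne : v ≠ π ⟨i, hin⟩ := by
          rintro rfl
          simp at hv
        obtain ⟨h1, h2, h3, h4⟩ := of_mem_verts_of_notMem_verts_stepInf hvi hne hd
        have h := ih.edges_iff _ h1 _ hvi
        exact ⟨⟨i, hin⟩, Nat.lt_succ_self i, h1, h2, h.1.1 h3, fun h5 => h4 (h.2.2 h5)⟩
      · obtain ⟨j, hj, h⟩ := ih.exists_of_dead v (by omega) hvi
        exact ⟨j, by omega, h⟩
    · rw [hs] at hv hd
      have hvi := verts_stepInf_subset hv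
      obtain ⟨h1, h2⟩ := notMem_uV_of_stepInf hv hd
      rcases Nat.lt_succ_iff_lt_or_eq.1 hj with hlt | heq
      · exact ih.dead_of_decided v hvi h1 j hlt he
      · obtain rfl : j = ⟨i, hin⟩ := Fin.ext heq
        exact fun h3 => h2 h3 ((ih.edges_iff _ h3 _ hvi).1.2 he)

lemma lfmisAux_univ_iff {n : ℕ} (E : Set (Sym2 (Fin n))) (π : Equiv.Perm (Fin n)) (i : Fin n) :
    lfmisAux Set.univ E π i ↔
      ∀ j : Fin n, j < i → s(π j, π i) ∈ E → ¬ lfmisAux Set.univ E π j := by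
  rw [lfmisAux]
  constructor
  · rintro ⟨-, h⟩ j hj he
    exact h j hj ⟨j.2, i.2, trivial, trivial, he⟩
  · intro h
    refine ⟨⟨i.2, trivial⟩, ?_⟩
    rintro j hj ⟨h1, h2, -, -, he⟩
    exact h ⟨j, h1⟩ hj he

/-- If `E` lies between the decided edges and all edges of the initial state, then away from the
influence set membership in the greedy MIS of `E` means being alive at one's own iteration. -/
lemma lfmisAux_iff_mem_verts {n : ℕ} (π : Equiv.Perm (Fin n)) {st0 : MISState n}
    (h0 : st0.verts = Finset.univ) {E : Set (Sym2 (Fin n))} (hE : E ⊆ st0.edges)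
    (hE' : ∀ e ∈ st0.edges, e ∉ st0.uE → e ∈ E) (i : Fin n)
    (hi : π i ∉ influenceMIS π st0) :
    lfmisAux Set.univ E π i ↔ π i ∈ (stateAt π st0 i).verts := by
  induction i using WellFoundedLT.induction with
  | ind i ih =>
    have inv := influenceInvariant π h0 i i.2.le
    have hmem : ∀ j : Fin n, π j ∈ influenceMIS π st0 ↔
        π j ∈ (stateAt π st0 j).verts ∧ π j ∈ (stateAt π st0 j).uV := by
      simp [influenceMIS]
    rw [lfmisAux_univ_iff]
    constructor
    · intro h
      by_contra hd
      obtain ⟨j, hj, h1, h2, h3, h4⟩ := inv.exists_of_dead (π i) (by simp) hd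
      exact h j hj (hE' _ h3 h4) ((ih j hj (fun h => h2 ((hmem j).1 h).2)).2 h1)
    · intro hv j hj he
      have hu : π i ∉ (stateAt π st0 i).uV := fun h => hi ((hmem i).2 ⟨hv, h⟩)
      have hd := inv.dead_of_decided (π i) hv hu j hj (hE he)
      exact fun h => hd ((ih j hj (fun h => hd ((hmem j).1 h).1)).1 h)


/-- Let `E₊` be a set of non-edges of `G`, `E₋ ⊆ E`, and
`E_new = (E ∪ E₊) \ E₋`.  Then for every permutation `π`,
`LFMIS((V,E),π) △ LFMIS((V,E_new),π) ⊆ InfluenceMIS((V, E ∪ E₊), ∅, E₊ ∪ E₋, 1)`. -/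
theorem lfmis_symmDiff_subset_influence {n : ℕ} (G : SimpleGraph (Fin n))
    [DecidableRel G.Adj] (Eplus Eminus : Finset (Sym2 (Fin n)))
    (hEp : ∀ e ∈ Eplus, ¬ e.IsDiag ∧ e ∉ G.edgeFinset)
    (hEm : Eminus ⊆ G.edgeFinset) (π : Equiv.Perm (Fin n)) :
    symmDiff (LFMISOn Set.univ ↑G.edgeFinset π)
        (LFMISOn Set.univ ↑((G.edgeFinset ∪ Eplus) \ Eminus) π)
      ⊆ ↑(influenceMIS π ⟨Finset.univ, G.edgeFinset ∪ Eplus, ∅, Eplus ∪ Eminus⟩) := by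
  intro v hv
  by_contra hI
  have key : ∀ E : Set (Sym2 (Fin n)), E ⊆ ↑(G.edgeFinset ∪ Eplus) →
      (∀ e ∈ G.edgeFinset ∪ Eplus, e ∉ Eplus ∪ Eminus → e ∈ E) →
      (v ∈ LFMISOn Set.univ E π ↔ v ∈ (stateAt π
        ⟨Finset.univ, G.edgeFinset ∪ Eplus, ∅, Eplus ∪ Eminus⟩ (π.symm v)).verts) := by
    intro E hE hE'
    simpa [LFMISOn] using lfmisAux_iff_mem_verts π
      (st0 := ⟨Finset.univ, G.edgeFinset ∪ Eplus, ∅, Eplus ∪ Eminus⟩) rfl hE hE' (π.symm v)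
      (by simpa using hI)
  have hold := key ↑G.edgeFinset (Finset.coe_subset.2 Finset.subset_union_left) (by
    intro e he hn
    simp only [Finset.mem_union, Finset.mem_coe] at *
    tauto)
  have hnew := key ↑((G.edgeFinset ∪ Eplus) \ Eminus)
    (Finset.coe_subset.2 Finset.sdiff_subset) (by
    intro e he hn
    simp only [Finset.mem_union, Finset.mem_sdiff, Finset.mem_coe] at *
    tauto)
  rw [Set.mem_symmDiff, hold, hnew] at hv
  tauto
end
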